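/- arXiv:1802.03734 — 2 statements merged into one kernel-verified Lean document; each statement's English description precedes it below -/
import Mathlib

section
/- Let n be a positive integer and let η, γ ∈ ℤ₊ⁿ be vectors of nonnegative integers with 𝟙ᵀη = 𝟙ᵀγ = k. Then the maximum of tr(X) over all matrices X ∈ ℤ₊^{n×n} of nonnegative integers satisfying X𝟙 = γ and Xᵀ𝟙 = η exists and equals ∑_{i=1}^{n} min{η_i, γ_i}. -/
/-- A nonnegative integer vector with total `m + 1` is a unit vector plus one with total `m`. -/
theorem exists_eq_add_single_of_sum_eq_succ {ι : Type*} [Fintype ι] [DecidableEq ι]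
    {a : ι → ℕ} {m : ℕ} (ha : ∑ i, a i = m + 1) :
    ∃ (i₀ : ι) (a' : ι → ℕ), a = a' + Pi.single i₀ 1 ∧ ∑ i, a' i = m := by
  obtain ⟨i₀, -, hi₀⟩ := Finset.exists_ne_zero_of_sum_ne_zero (ha.trans_ne m.succ_ne_zero)
  have h : a = (a - Pi.single i₀ 1) + Pi.single i₀ 1 := by
    funext i
    by_cases hi : i = i₀
    · subst hi
      simp only [Pi.add_apply, Pi.sub_apply, Pi.single_eq_same]
      omega
    · simp [hi]
  refine ⟨i₀, a - Pi.single i₀ 1, h, ?_⟩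
  rw [h] at ha
  simpa [Finset.sum_add_distrib] using ha

/-- Nonnegative integer marginals with equal totals are realised by a nonnegative integer
matrix. -/
theorem Matrix.exists_nat_of_row_sum_of_col_sum {ι κ : Type*} [Fintype ι] [Fintype κ]
    (a : ι → ℕ) (b : κ → ℕ) (hab : ∑ i, a i = ∑ j, b j) :
    ∃ Y : Matrix ι κ ℕ, (∀ i, ∑ j, Y i j = a i) ∧ (∀ j, ∑ i, Y i j = b j) := by
  classical
  obtain ⟨m, hm⟩ : ∃ m, ∑ i, a i = m := ⟨_, rfl⟩
  induction m generalizing a b with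
  | zero =>
    have ha := Finset.sum_eq_zero_iff.mp hm
    have hb := Finset.sum_eq_zero_iff.mp (hab.symm.trans hm)
    exact ⟨0, fun i => by simp [ha i], fun j => by simp [hb j]⟩
  | succ m ih =>
    obtain ⟨i₀, a', rfl, ha'⟩ := exists_eq_add_single_of_sum_eq_succ hm
    obtain ⟨j₀, b', rfl, hb'⟩ := exists_eq_add_single_of_sum_eq_succ (hab.symm.trans hm)
    obtain ⟨Y, hrow, hcol⟩ := ih a' b' (ha'.trans hb'.symm) ha'
    refine ⟨Y + Matrix.of fun i j => Pi.single (M := fun _ => ℕ) i₀ 1 i *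
      Pi.single (M := fun _ => ℕ) j₀ 1 j, fun i => ?_, fun j => ?_⟩
    · simp [Finset.sum_add_distrib, hrow, ← Finset.mul_sum]
    · simp [Finset.sum_add_distrib, hcol, ← Finset.sum_mul]


/-- For nonnegative integer marginals `η, γ` with equal total `k`, the maximum
of the trace over all nonnegative integer `n × n` matrices with row sums `γ` and column sums `η`
exists and equals `∑ i, min (η i) (γ i)`. -/
theorem trace_max_transportation_nat (n : ℕ) (hn : 0 < n) (η γ : Fin n → ℕ) (k : ℕ)
    (hη : ∑ i, η i = k) (hγ : ∑ i, γ i = k) :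
    IsGreatest {t : ℕ | ∃ X : Matrix (Fin n) (Fin n) ℕ,
        (∀ i, ∑ j, X i j = γ i) ∧ (∀ j, ∑ i, X i j = η j) ∧ t = ∑ i, X i i}
      (∑ i, min (η i) (γ i)) := by
  constructor
  · have hsub (a b : Fin n → ℕ) :
        ∑ i, (a i - min (a i) (b i)) + ∑ i, min (a i) (b i) = ∑ i, a i := by
      rw [← Finset.sum_add_distrib]
      exact Finset.sum_congr rfl fun i _ => Nat.sub_add_cancel (min_le_left _ _)
    obtain ⟨Y, hrow, hcol⟩ := Matrix.exists_nat_of_row_sum_of_col_sum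
      (fun i => γ i - min (γ i) (η i)) (fun j => η j - min (η j) (γ j)) (by
        have h₁ := hsub γ η
        have h₂ := hsub η γ
        simp only [min_comm (γ _)] at h₁ ⊢
        omega)
    have hdiag (i : Fin n) : Y i i = 0 := by
      have h₁ := (Finset.single_le_sum_of_canonicallyOrdered (f := fun j => Y i j)
        (Finset.mem_univ i)).trans_eq (hrow i)
      have h₂ := (Finset.single_le_sum_of_canonicallyOrdered (f := fun j => Y j i)
        (Finset.mem_univ i)).trans_eq (hcol i)
      omega
    refine ⟨Matrix.diagonal (fun i => min (η i) (γ i)) + Y, fun i => ?_, fun j => ?_, ?_⟩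
    · simp only [Matrix.add_apply, Finset.sum_add_distrib, hrow, Matrix.diagonal_apply,
        Finset.sum_ite_eq, Finset.mem_univ, if_true]
      omega
    · simp only [Matrix.add_apply, Finset.sum_add_distrib, hcol, Matrix.diagonal_apply,
        Finset.sum_ite_eq', Finset.mem_univ, if_true]
      omega
    · simp [hdiag]
  · rintro t ⟨X, hrow, hcol, rfl⟩
    refine Finset.sum_le_sum fun i _ => le_min ?_ ?_
    · rw [← hcol i]
      exact Finset.single_le_sum_of_canonicallyOrdered (f := fun j => X j i) (Finset.mem_univ i)
    · rw [← hrow i]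
      exact Finset.single_le_sum_of_canonicallyOrdered (f := fun j => X i j) (Finset.mem_univ i)
end

section
/- Let n be a positive integer and let η, γ ∈ ℤ₊ⁿ satisfy 𝟙ᵀη = 𝟙ᵀγ. Then there exists a matrix X ∈ ℤ₊^{n×n} with X𝟙 = γ and Xᵀ𝟙 = η such that tr(X) = ∑_{i=1}^{n} min{η_i, γ_i}. -/
theorem pi_single_one_le {ι : Type*} [DecidableEq ι] {f : ι → ℕ} {i : ι} (hi : f i ≠ 0) :
    Pi.single i 1 ≤ f := by
  intro j
  obtain rfl | hj := eq_or_ne j i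
  · simpa using Nat.one_le_iff_ne_zero.2 hi
  · simp [hj]

/-- Two families of natural numbers with equal totals are the row sums and the column sums of a
matrix of natural numbers. -/
theorem exists_matrix_row_sums_col_sums {ι κ : Type*} [Fintype ι] [Fintype κ]
    (r : ι → ℕ) (c : κ → ℕ) (h : ∑ i, r i = ∑ j, c j) :
    ∃ X : Matrix ι κ ℕ, (∀ i, ∑ j, X i j = r i) ∧ ∀ j, ∑ i, X i j = c j := by
  classical
  induction hN : ∑ i, r i generalizing r c with
  | zero =>
    have hr : ∀ i, r i = 0 := by simpa using hN
    have hc : ∀ j, c j = 0 := by simpa using h.symm.trans hN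
    exact ⟨0, by simp [hr], by simp [hc]⟩
  | succ N ih =>
    obtain ⟨i₀, -, hi₀⟩ := Finset.exists_ne_zero_of_sum_ne_zero (hN.trans_ne N.succ_ne_zero)
    obtain ⟨j₀, -, hj₀⟩ :=
      Finset.exists_ne_zero_of_sum_ne_zero ((h.symm.trans hN).trans_ne N.succ_ne_zero)
    have hr : r = (r - Pi.single i₀ 1) + Pi.single i₀ 1 :=
      (tsub_add_cancel_of_le (pi_single_one_le hi₀)).symm
    have hc : c = (c - Pi.single j₀ 1) + Pi.single j₀ 1 :=
      (tsub_add_cancel_of_le (pi_single_one_le hj₀)).symm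
    generalize r - Pi.single i₀ 1 = r' at hr
    generalize c - Pi.single j₀ 1 = c' at hc
    subst hr hc
    simp only [Pi.add_apply, Finset.sum_add_distrib, Finset.sum_pi_single',
      Finset.mem_univ, if_true, add_left_inj] at h hN
    obtain ⟨X, hXr, hXc⟩ := ih r' c' h hN
    refine ⟨X + Matrix.single i₀ j₀ 1, fun i => ?_, fun j => ?_⟩
    · simp [Finset.sum_add_distrib, hXr, Matrix.single_apply, Pi.single_apply, ite_and, eq_comm]
    · simp [Finset.sum_add_distrib, hXc, Matrix.single_apply, Pi.single_apply, ite_and, eq_comm]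

/-- For nonnegative integer marginals `η, γ` with equal totals, there exists a
nonnegative integer matrix with row sums `γ` and column sums `η` whose trace is
`∑ i, min (η i) (γ i)`. -/
theorem exists_transportation_matrix_trace_eq_sum_min (n : ℕ) (hn : 0 < n)
    (η γ : Fin n → ℕ) (hsum : ∑ i, η i = ∑ i, γ i) :
    ∃ X : Matrix (Fin n) (Fin n) ℕ,
      (∀ i, ∑ j, X i j = γ i) ∧ (∀ j, ∑ i, X i j = η j) ∧
      ∑ i, X i i = ∑ i, min (η i) (γ i) := by
  obtain ⟨Y, hYr, hYc⟩ := exists_matrix_row_sums_col_sums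
    (fun i => γ i - min (η i) (γ i)) (fun j => η j - min (η j) (γ j)) (by
      rw [Finset.sum_tsub_distrib _ fun i _ => min_le_right _ _,
        Finset.sum_tsub_distrib _ fun i _ => min_le_left _ _, hsum])
  have hY : ∀ i, Y i i = 0 := fun i => by
    have hr : Y i i ≤ ∑ j, Y i j :=
      Finset.single_le_sum (fun j _ => Nat.zero_le (Y i j)) (Finset.mem_univ i)
    have hc : Y i i ≤ ∑ k, Y k i :=
      Finset.single_le_sum (fun k _ => Nat.zero_le (Y k i)) (Finset.mem_univ i)
    rw [hYr] at hr
    rw [hYc] at hc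
    omega
  refine ⟨Matrix.diagonal (fun i => min (η i) (γ i)) + Y, fun i => ?_, fun j => ?_, ?_⟩
  · simp [Finset.sum_add_distrib, hYr, Matrix.diagonal_apply]
  · simp [Finset.sum_add_distrib, hYc, Matrix.diagonal_apply]
  · simp [hY]
end
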